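/- arXiv:2605.20283 — 2 statements merged into one kernel-verified Lean document; each statement's English description precedes it below -/
import Mathlib

section
/- Let ξ > 0, let n ≥ 2 and t₁ < t₂ < ⋯ < tₙ be real numbers, and let R̃ be the n×n tridiagonal matrix with R̃₁,₁ = (A^{[1]}_{t₁,t₂})′(t₁), R̃₁,₂ = (B^{[1]}_{t₁,t₂})′(t₁); for 2 ≤ j ≤ n−1: R̃_{j,j−1} = (A^{[1]}_{t_{j−1},t_j})′(t_j), R̃_{j,j} = (B^{[1]}_{t_{j−1},t_j})′(t_j) − (A^{[1]}_{t_j,t_{j+1}})′(t_j), R̃_{j,j+1} = −(B^{[1]}_{t_j,t_{j+1}})′(t_j); R̃_{n,n−1} = (A^{[1]}_{t_{n−1},t_n})′(t_n), R̃_{n,n} = (B^{[1]}_{t_{n−1},t_n})′(t_n); all other entries zero. Then for any data g₁, …, gₙ ∈ ℝ and any d₁, d₂ ∈ ℝ there exists a unique vector γ = (γ₁, …, γₙ) ∈ ℝⁿ with R̃γ = x, where x₁ = −(A^{[2]}_{t₁,t₂})′(t₁)g₁ − (B^{[2]}_{t₁,t₂})′(t₁)g₂ + d₁, x_j = −(A^{[2]}_{t_{j−1},t_j})′(t_j)g_{j−1}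 + ((A^{[2]}_{t_j,t_{j+1}})′(t_j) − (B^{[2]}_{t_{j−1},t_j})′(t_j))g_j + (B^{[2]}_{t_j,t_{j+1}})′(t_j)g_{j+1} for 2 ≤ j ≤ n−1, and xₙ = −(A^{[2]}_{t_{n−1},t_n})′(tₙ)g_{n−1} − (B^{[2]}_{t_{n−1},t_n})′(tₙ)gₙ + d₂. -/
/-- `Φ_ξ(t) = (ξ t cosh(ξ t) − sinh(ξ t)) / (2 ξ³)`. -/
noncomputable def Phi (ξ t : ℝ) : ℝ :=
  (ξ * t * Real.cosh (ξ * t) - Real.sinh (ξ * t)) / (2 * ξ ^ 3)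

/-- `ψ_ξ(t) = sinh(ξ t) / ξ`. -/
noncomputable def psi (ξ t : ℝ) : ℝ := Real.sinh (ξ * t) / ξ

/-- `A^{[2]}_{a,b}(t) = sinh(ξ(t−b)) / sinh(ξ(a−b))`. -/
noncomputable def A2 (ξ a b t : ℝ) : ℝ :=
  Real.sinh (ξ * (t - b)) / Real.sinh (ξ * (a - b))

/-- `B^{[2]}_{a,b}(t) = sinh(ξ(t−a)) / sinh(ξ(b−a))`. -/
noncomputable def B2 (ξ a b t : ℝ) : ℝ :=
  Real.sinh (ξ * (t - a)) / Real.sinh (ξ * (b - a))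

/-- `A^{[1]}_{a,b}(t) = Φ_ξ(t−b)/ψ_ξ(a−b) − A^{[2]}_{a,b}(t)·Φ_ξ(a−b)/ψ_ξ(a−b)`. -/
noncomputable def A1 (ξ a b t : ℝ) : ℝ :=
  Phi ξ (t - b) / psi ξ (a - b) - A2 ξ a b t * (Phi ξ (a - b) / psi ξ (a - b))

/-- `B^{[1]}_{a,b}(t) = Φ_ξ(t−a)/ψ_ξ(b−a) − (Φ_ξ(b−a)/ψ_ξ(b−a))·B^{[2]}_{a,b}(t)`. -/
noncomputable def B1 (ξ a b t : ℝ) : ℝ :=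
  Phi ξ (t - a) / psi ξ (b - a) - Phi ξ (b - a) / psi ξ (b - a) * B2 ξ a b t

/-- `ρ(t) = (sinh(2ξt) − 2ξt) / (4ξ sinh²(ξt))`. -/
noncomputable def rho (ξ t : ℝ) : ℝ :=
  (Real.sinh (2 * ξ * t) - 2 * ξ * t) / (4 * ξ * Real.sinh (ξ * t) ^ 2)

/-- `σ(t) = (ξ t cosh(ξ t) − sinh(ξ t)) / (2ξ sinh²(ξt))`. -/
noncomputable def sigma (ξ t : ℝ) : ℝ :=
  (ξ * t * Real.cosh (ξ * t) - Real.sinh (ξ * t)) / (2 * ξ * Real.sinh (ξ * t) ^ 2)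

theorem hasDerivAt_Phi {ξ : ℝ} (hξ : ξ ≠ 0) (t : ℝ) :
    HasDerivAt (Phi ξ) (t * Real.sinh (ξ * t) / (2 * ξ)) t := by
  have hlin : HasDerivAt (fun t : ℝ => ξ * t) ξ t := by
    simpa using (hasDerivAt_id t).const_mul ξ
  refine (((hlin.mul hlin.cosh).sub hlin.sinh).div_const (2 * ξ ^ 3)).congr_deriv ?_
  field_simp
  ring

theorem hasDerivAt_A2 (ξ a b t : ℝ) :
    HasDerivAt (A2 ξ a b) (ξ * Real.cosh (ξ * (t - b)) / Real.sinh (ξ * (a - b))) t := by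
  have hlin : HasDerivAt (fun t : ℝ => ξ * (t - b)) ξ t := by
    simpa using ((hasDerivAt_id t).sub_const b).const_mul ξ
  exact (hlin.sinh.div_const _).congr_deriv (by ring)

theorem A1_eq_B1_swap (ξ a b : ℝ) : A1 ξ a b = B1 ξ b a := by
  funext t
  simp only [A1, B1, A2, B2]
  ring

theorem hasDerivAt_A1 {ξ : ℝ} (hξ : ξ ≠ 0) (a b t : ℝ) :
    HasDerivAt (A1 ξ a b)
      ((t - b) * Real.sinh (ξ * (t - b)) / (2 * ξ) / psi ξ (a - b)
        - ξ * Real.cosh (ξ * (t - b)) / Real.sinh (ξ * (a - b))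
          * (Phi ξ (a - b) / psi ξ (a - b))) t :=
  (((hasDerivAt_Phi hξ (t - b)).comp_sub_const t b).div_const _).sub
    ((hasDerivAt_A2 ξ a b t).mul_const _)

theorem rho_neg (ξ t : ℝ) : rho ξ (-t) = -rho ξ t := by
  simp only [rho, mul_neg, Real.sinh_neg]
  ring

theorem sigma_neg (ξ t : ℝ) : sigma ξ (-t) = -sigma ξ t := by
  simp only [sigma, mul_neg, neg_mul, Real.sinh_neg, Real.cosh_neg]
  ring

theorem deriv_A1_right {ξ a b : ℝ} (hξ : ξ ≠ 0) (hab : a ≠ b) :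
    deriv (A1 ξ a b) b = sigma ξ (b - a) := by
  have hs : Real.sinh (ξ * (a - b)) ≠ 0 :=
    Real.sinh_ne_zero.2 (mul_ne_zero hξ (sub_ne_zero.2 hab))
  rw [(hasDerivAt_A1 hξ a b b).deriv, ← neg_sub a b, sigma_neg]
  simp only [sub_self, mul_zero, Real.cosh_zero, Real.sinh_zero, sigma, psi, Phi]
  field_simp
  ring

theorem deriv_A1_left {ξ a b : ℝ} (hξ : ξ ≠ 0) (hab : a ≠ b) :
    deriv (A1 ξ a b) a = -rho ξ (b - a) := by
  have hs : Real.sinh (ξ * (a - b)) ≠ 0 :=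
    Real.sinh_ne_zero.2 (mul_ne_zero hξ (sub_ne_zero.2 hab))
  rw [(hasDerivAt_A1 hξ a b a).deriv, ← neg_sub a b, rho_neg]
  have h2 : 2 * ξ * (a - b) = 2 * (ξ * (a - b)) := by ring
  simp only [rho, psi, Phi, h2, Real.sinh_two_mul]
  have hcs := Real.cosh_sq (ξ * (a - b))
  generalize Real.sinh (ξ * (a - b)) = s at *
  generalize Real.cosh (ξ * (a - b)) = c at *
  field_simp
  linear_combination (-4 * ξ * (a - b)) * hcs

theorem deriv_B1_left {ξ a b : ℝ} (hξ : ξ ≠ 0) (hab : a ≠ b) :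
    deriv (B1 ξ a b) a = -sigma ξ (b - a) := by
  rw [← A1_eq_B1_swap, deriv_A1_right hξ hab.symm, ← sigma_neg, neg_sub]

theorem deriv_B1_right {ξ a b : ℝ} (hξ : ξ ≠ 0) (hab : a ≠ b) :
    deriv (B1 ξ a b) b = rho ξ (b - a) := by
  rw [← A1_eq_B1_swap, deriv_A1_left hξ hab.symm, ← rho_neg, neg_sub]

theorem abs_sigma_lt_rho {ξ t : ℝ} (hξ : 0 < ξ) (ht : 0 < t) : |sigma ξ t| < rho ξ t := by
  have hu : 0 < ξ * t := mul_pos hξ ht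
  have hs : ξ * t < Real.sinh (ξ * t) := Real.self_lt_sinh_iff.2 hu
  have hc : 1 < Real.cosh (ξ * t) := Real.one_lt_cosh.2 hu.ne'
  have hden : 0 < 2 * ξ * Real.sinh (ξ * t) ^ 2 := by
    have := hu.trans hs
    positivity
  have hrho : rho ξ t =
      (Real.sinh (ξ * t) * Real.cosh (ξ * t) - ξ * t) / (2 * ξ * Real.sinh (ξ * t) ^ 2) := by
    have h2 : 2 * ξ * t = 2 * (ξ * t) := by ring
    rw [rho, h2, Real.sinh_two_mul, div_eq_div_iff (by linarith) hden.ne']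
    ring
  rw [hrho, sigma, abs_div, abs_of_pos hden]
  refine div_lt_div_of_pos_right (abs_lt.2 ⟨?_, ?_⟩) hden
  · nlinarith
  · nlinarith

theorem Matrix.existsUnique_mulVec_eq {ι K : Type*} [Fintype ι] [DecidableEq ι] [Field K]
    {A : Matrix ι ι K} (hA : A.det ≠ 0) (x : ι → K) : ∃! v : ι → K, A.mulVec v = x := by
  have hinj : Function.Injective A.mulVec :=
    Matrix.mulVec_injective_of_isUnit ((Matrix.isUnit_iff_isUnit_det A).2 hA.isUnit)
  obtain ⟨v, hv⟩ := Matrix.mulVec_surjective_iff_isUnit.2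
    ((Matrix.isUnit_iff_isUnit_det A).2 hA.isUnit) x
  exact ⟨v, hv, fun w hw => hinj (hw.trans hv.symm)⟩

/-- For the clamped `L`-spline interpolation system `R̃ γ = x`, for any data
`g₁, …, gₙ` and endpoint derivative data `d₁, d₂` there is a unique solution `γ`. -/
theorem clamped_system_unique_solution (ξ : ℝ) (hξ : 0 < ξ) (n : ℕ) (hn : 2 ≤ n)
    (t : Fin n → ℝ) (ht : StrictMono t) (R : Matrix (Fin n) (Fin n) ℝ)
    (hR11 : R ⟨0, by omega⟩ ⟨0, by omega⟩ =
      deriv (A1 ξ (t ⟨0, by omega⟩) (t ⟨1, by omega⟩)) (t ⟨0, by omega⟩))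
    (hR12 : R ⟨0, by omega⟩ ⟨1, by omega⟩ =
      deriv (B1 ξ (t ⟨0, by omega⟩) (t ⟨1, by omega⟩)) (t ⟨0, by omega⟩))
    (hsub : ∀ (j : ℕ) (h1 : 1 ≤ j) (h2 : j ≤ n - 2),
      R ⟨j, by omega⟩ ⟨j - 1, by omega⟩ =
        deriv (A1 ξ (t ⟨j - 1, by omega⟩) (t ⟨j, by omega⟩)) (t ⟨j, by omega⟩))
    (hdiag : ∀ (j : ℕ) (h1 : 1 ≤ j) (h2 : j ≤ n - 2),
      R ⟨j, by omega⟩ ⟨j, by omega⟩ =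
        deriv (B1 ξ (t ⟨j - 1, by omega⟩) (t ⟨j, by omega⟩)) (t ⟨j, by omega⟩)
          - deriv (A1 ξ (t ⟨j, by omega⟩) (t ⟨j + 1, by omega⟩)) (t ⟨j, by omega⟩))
    (hsup : ∀ (j : ℕ) (h1 : 1 ≤ j) (h2 : j ≤ n - 2),
      R ⟨j, by omega⟩ ⟨j + 1, by omega⟩ =
        -deriv (B1 ξ (t ⟨j, by omega⟩) (t ⟨j + 1, by omega⟩)) (t ⟨j, by omega⟩))
    (hRn1 : R ⟨n - 1, by omega⟩ ⟨n - 2, by omega⟩ =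
      deriv (A1 ξ (t ⟨n - 2, by omega⟩) (t ⟨n - 1, by omega⟩)) (t ⟨n - 1, by omega⟩))
    (hRnn : R ⟨n - 1, by omega⟩ ⟨n - 1, by omega⟩ =
      deriv (B1 ξ (t ⟨n - 2, by omega⟩) (t ⟨n - 1, by omega⟩)) (t ⟨n - 1, by omega⟩))
    (hzero : ∀ i j : Fin n,
      ¬((j : ℕ) = (i : ℕ) ∨ (j : ℕ) + 1 = (i : ℕ) ∨ (i : ℕ) + 1 = (j : ℕ)) →
        R i j = 0)
    (g : Fin n → ℝ) (d₁ d₂ : ℝ) (x : Fin n → ℝ)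
    (hx1 : x ⟨0, by omega⟩ =
      -deriv (A2 ξ (t ⟨0, by omega⟩) (t ⟨1, by omega⟩)) (t ⟨0, by omega⟩) * g ⟨0, by omega⟩
        - deriv (B2 ξ (t ⟨0, by omega⟩) (t ⟨1, by omega⟩)) (t ⟨0, by omega⟩) * g ⟨1, by omega⟩
        + d₁)
    (hxj : ∀ (j : ℕ) (h1 : 1 ≤ j) (h2 : j ≤ n - 2),
      x ⟨j, by omega⟩ =
        -deriv (A2 ξ (t ⟨j - 1, by omega⟩) (t ⟨j, by omega⟩)) (t ⟨j, by omega⟩)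
            * g ⟨j - 1, by omega⟩
          + (deriv (A2 ξ (t ⟨j, by omega⟩) (t ⟨j + 1, by omega⟩)) (t ⟨j, by omega⟩)
              - deriv (B2 ξ (t ⟨j - 1, by omega⟩) (t ⟨j, by omega⟩)) (t ⟨j, by omega⟩))
            * g ⟨j, by omega⟩
          + deriv (B2 ξ (t ⟨j, by omega⟩) (t ⟨j + 1, by omega⟩)) (t ⟨j, by omega⟩)
            * g ⟨j + 1, by omega⟩)
    (hxn : x ⟨n - 1, by omega⟩ =
      -deriv (A2 ξ (t ⟨n - 2, by omega⟩) (t ⟨n - 1, by omega⟩)) (t ⟨n - 1, by omega⟩)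
          * g ⟨n - 2, by omega⟩
        - deriv (B2 ξ (t ⟨n - 2, by omega⟩) (t ⟨n - 1, by omega⟩)) (t ⟨n - 1, by omega⟩)
          * g ⟨n - 1, by omega⟩
        + d₂) :
    ∃! γ : Fin n → ℝ, R.mulVec γ = x := by
  have hξ' : ξ ≠ 0 := hξ.ne'
  have hlt : ∀ (i j : ℕ) (hi : i < n) (hj : j < n), i < j → t ⟨i, hi⟩ < t ⟨j, hj⟩ :=
    fun i j hi hj hij => ht (Fin.mk_lt_mk.2 hij)
  have hdom : ∀ (i j : ℕ) (hi : i < n) (hj : j < n), i < j →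
      |sigma ξ (t ⟨j, hj⟩ - t ⟨i, hi⟩)| < rho ξ (t ⟨j, hj⟩ - t ⟨i, hi⟩) :=
    fun i j hi hj hij => abs_sigma_lt_rho hξ (sub_pos.2 (hlt i j hi hj hij))
  refine Matrix.existsUnique_mulVec_eq (det_ne_zero_of_sum_row_lt_diag fun k => ?_) x
  have hsum : ∀ s : Finset (Fin n), k ∉ s →
      (∀ j : Fin n, (j : ℕ) + 1 = k ∨ (k : ℕ) + 1 = j → j ∈ s) →
      ∑ j ∈ Finset.univ.erase k, ‖R k j‖ = ∑ j ∈ s, ‖R k j‖ := by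
    intro s hks hs
    refine (Finset.sum_subset (fun j hj => ?_) fun j hj hjs => ?_).symm
    · simpa using ne_of_mem_of_not_mem hj hks
    · rw [hzero k j, norm_zero]
      rintro (h | h)
      · exact Finset.ne_of_mem_erase hj (Fin.ext h)
      · exact hjs (hs j h)
  obtain ⟨k, hk⟩ := k
  rcases Nat.eq_zero_or_pos k with rfl | hk0
  · have h01 := hlt 0 1 (by omega) (by omega) one_pos
    have hd := hdom 0 1 (by omega) (by omega) one_pos
    rw [hsum {⟨1, by omega⟩}
        (by simp only [Finset.mem_singleton, Fin.ext_iff]; omega)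
        (fun j hj => by
        simp only [Finset.mem_singleton, Fin.ext_iff] at *; omega),
      Finset.sum_singleton, hR11, hR12, deriv_A1_left hξ' h01.ne, deriv_B1_left hξ' h01.ne,
      norm_neg, norm_neg, Real.norm_eq_abs, Real.norm_eq_abs]
    exact hd.trans_le (le_abs_self _)
  have hprev := hlt (k - 1) k (by omega) hk (by omega)
  have hdprev := hdom (k - 1) k (by omega) hk (by omega)
  rcases Nat.lt_or_ge (n - 2) k with hkn | hkn
  · obtain rfl : k = n - 1 := by omega
    have hlast := hlt (n - 2) (n - 1) (by omega) hk (by omega)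
    have hdlast := hdom (n - 2) (n - 1) (by omega) hk (by omega)
    rw [hsum {⟨n - 2, by omega⟩}
        (by simp only [Finset.mem_singleton, Fin.ext_iff]; omega)
        (fun j hj => by simp only [Finset.mem_singleton, Fin.ext_iff] at *; omega),
      Finset.sum_singleton, hRn1, hRnn, deriv_A1_right hξ' hlast.ne,
      deriv_B1_right hξ' hlast.ne, Real.norm_eq_abs, Real.norm_eq_abs]
    exact hdlast.trans_le (le_abs_self _)
  · have hnext := hlt k (k + 1) hk (by omega) (by omega)
    have hdnext := hdom k (k + 1) hk (by omega) (by omega)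
    rw [hsum {⟨k - 1, by omega⟩, ⟨k + 1, by omega⟩}
        (by simp only [Finset.mem_insert, Finset.mem_singleton, Fin.ext_iff]; omega)
        (fun j hj => by
          simp only [Finset.mem_insert, Finset.mem_singleton, Fin.ext_iff] at *; omega),
      Finset.sum_pair (by simp only [ne_eq, Fin.ext_iff]; omega), hsub k hk0 hkn,
      hdiag k hk0 hkn, hsup k hk0 hkn, deriv_A1_right hξ' hprev.ne, deriv_B1_right hξ' hprev.ne,
      deriv_A1_left hξ' hnext.ne, deriv_B1_left hξ' hnext.ne, neg_neg, sub_neg_eq_add]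
    simp only [Real.norm_eq_abs]
    exact (add_lt_add hdprev hdnext).trans_le (le_abs_self _)
end

section
/- Let ξ > 0, a < b be real numbers, and γ₁, γ₂, g₁, g₂ ∈ ℝ. Define ψ(t) = γ₁ A^{[1]}_{a,b}(t) + γ₂ B^{[1]}_{a,b}(t) + g₁ A^{[2]}_{a,b}(t) + g₂ B^{[2]}_{a,b}(t). Then ψ satisfies the fourth-order equation ψ⁗(t) − 2ξ² ψ″(t) + ξ⁴ ψ(t) = 0 for all real t, together with the boundary conditions ψ(a) = g₁, ψ(b) = g₂, ψ″(a) − ξ² ψ(a) = γ₁, and ψ″(b) − ξ² ψ(b) = γ₂. -/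
theorem hasDerivAt_sinh_mul_sub (ξ c t : ℝ) :
    HasDerivAt (fun t => Real.sinh (ξ * (t - c))) (ξ * Real.cosh (ξ * (t - c))) t := by
  refine HasDerivAt.congr_deriv ((((hasDerivAt_id' t).sub_const c).const_mul ξ).sinh) ?_
  ring

theorem hasDerivAt_cosh_mul_sub (ξ c t : ℝ) :
    HasDerivAt (fun t => Real.cosh (ξ * (t - c))) (ξ * Real.sinh (ξ * (t - c))) t := by
  refine HasDerivAt.congr_deriv ((((hasDerivAt_id' t).sub_const c).const_mul ξ).cosh) ?_
  ring

theorem hasDerivAt_Phi_sub {ξ : ℝ} (hξ : ξ ≠ 0) (c t : ℝ) :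
    HasDerivAt (fun t => Phi ξ (t - c)) ((t - c) * Real.sinh (ξ * (t - c)) / (2 * ξ)) t := by
  unfold Phi
  refine HasDerivAt.congr_deriv ((((((hasDerivAt_id' t).sub_const c).const_mul ξ).mul
    (hasDerivAt_cosh_mul_sub ξ c t)).sub (hasDerivAt_sinh_mul_sub ξ c t)).div_const
    (2 * ξ ^ 3)) ?_
  field_simp
  ring

theorem hasDerivAt_deriv_Phi_sub {ξ : ℝ} (hξ : ξ ≠ 0) (c t : ℝ) :
    HasDerivAt (fun t => (t - c) * Real.sinh (ξ * (t - c)) / (2 * ξ))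
      (ξ ^ 2 * Phi ξ (t - c) + Real.sinh (ξ * (t - c)) / ξ) t := by
  refine HasDerivAt.congr_deriv ((((hasDerivAt_id' t).sub_const c).mul
    (hasDerivAt_sinh_mul_sub ξ c t)).div_const (2 * ξ)) ?_
  unfold Phi
  field_simp
  ring

/-- Linear combinations of `sinh (ξ (t - c))` and `Φ_ξ (t - c)` for `c = a, b`; this family is
closed under taking second derivatives. -/
noncomputable def sinhPhiComb (ξ a b p q r s t : ℝ) : ℝ :=
  p * Real.sinh (ξ * (t - a)) + q * Phi ξ (t - a)
    + (r * Real.sinh (ξ * (t - b)) + s * Phi ξ (t - b))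

theorem deriv_deriv_sinhPhiComb {ξ : ℝ} (hξ : ξ ≠ 0) (a b p q r s : ℝ) :
    deriv (deriv (sinhPhiComb ξ a b p q r s)) =
      sinhPhiComb ξ a b (ξ ^ 2 * p + q / ξ) (ξ ^ 2 * q) (ξ ^ 2 * r + s / ξ) (ξ ^ 2 * s) := by
  have h1 : deriv (sinhPhiComb ξ a b p q r s) = _ := funext fun t =>
    ((((hasDerivAt_sinh_mul_sub ξ a t).const_mul p).add
      ((hasDerivAt_Phi_sub hξ a t).const_mul q)).add
      (((hasDerivAt_sinh_mul_sub ξ b t).const_mul r).add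
      ((hasDerivAt_Phi_sub hξ b t).const_mul s))).deriv
  rw [h1]
  funext t
  refine HasDerivAt.deriv ?_
  refine HasDerivAt.congr_deriv ((((((hasDerivAt_cosh_mul_sub ξ a t).const_mul ξ).const_mul p).add
      ((hasDerivAt_deriv_Phi_sub hξ a t).const_mul q)).add
      ((((hasDerivAt_cosh_mul_sub ξ b t).const_mul ξ).const_mul r).add
      ((hasDerivAt_deriv_Phi_sub hξ b t).const_mul s)))) ?_
  unfold sinhPhiComb
  ring

/-- `ψ(t) = γ₁ A^{[1]}(t) + γ₂ B^{[1]}(t) + g₁ A^{[2]}(t) + g₂ B^{[2]}(t)` satisfies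
`ψ⁗ − 2ξ²ψ″ + ξ⁴ψ = 0` with `ψ(a) = g₁`, `ψ(b) = g₂`, `ψ″(a) − ξ²ψ(a) = γ₁`,
`ψ″(b) − ξ²ψ(b) = γ₂`. -/
theorem spline_piece_ode (ξ a b γ₁ γ₂ g₁ g₂ : ℝ) (hξ : 0 < ξ) (hab : a < b)
    (f : ℝ → ℝ)
    (hf : ∀ t : ℝ, f t = γ₁ * A1 ξ a b t + γ₂ * B1 ξ a b t
      + g₁ * A2 ξ a b t + g₂ * B2 ξ a b t) :
    (∀ t : ℝ, deriv^[4] f t - 2 * ξ ^ 2 * deriv^[2] f t + ξ ^ 4 * f t = 0) ∧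
    f a = g₁ ∧ f b = g₂ ∧
    deriv^[2] f a - ξ ^ 2 * f a = γ₁ ∧ deriv^[2] f b - ξ ^ 2 * f b = γ₂ := by
  have hξ0 : ξ ≠ 0 := hξ.ne'
  have hS : Real.sinh (ξ * (b - a)) ≠ 0 :=
    (Real.sinh_pos_iff.2 (mul_pos hξ (sub_pos.2 hab))).ne'
  have hneg : ξ * (a - b) = -(ξ * (b - a)) := by ring
  have hA : Real.sinh (ξ * (a - b)) ≠ 0 := by
    rw [hneg, Real.sinh_neg]
    exact neg_ne_zero.2 hS
  have hfeq : f = sinhPhiComb ξ a b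
      (g₂ / Real.sinh (ξ * (b - a))
        - γ₂ * (Phi ξ (b - a) / psi ξ (b - a)) / Real.sinh (ξ * (b - a)))
      (γ₂ / psi ξ (b - a))
      (g₁ / Real.sinh (ξ * (a - b))
        - γ₁ * (Phi ξ (a - b) / psi ξ (a - b)) / Real.sinh (ξ * (a - b)))
      (γ₁ / psi ξ (a - b)) := by
    funext t
    rw [hf t]
    unfold A1 B1 A2 B2 sinhPhiComb
    ring
  have hPhi : Phi ξ 0 = 0 := by simp [Phi]
  have hf2 := deriv_deriv_sinhPhiComb hξ0 a b
  simp only [Function.iterate_succ, Function.iterate_zero, Function.comp_apply, id]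
  rw [hfeq]
  simp only [hf2]
  refine ⟨fun t => ?_, ?_, ?_, ?_, ?_⟩ <;>
    simp only [sinhPhiComb, sub_self, mul_zero, Real.sinh_zero, hPhi, psi] <;>
    field_simp <;> ring
end
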